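/- arXiv:1406.2296 — 3 statements merged into one kernel-verified Lean document; each statement's English description precedes it below -/
import Mathlib

section
/- Let A, B ∈ [−1,1]^{n×n} be the payoff matrices of a bimatrix game, let C = A + B, let ε > 0, let p ≥ 2, and let u ∈ ℝ^n. Suppose x, y ∈ Δ^n and π_1, π_2 ∈ [−1,1] satisfy: x^T u ≥ π_1 + π_2 − ε/2, (A y)_i ≤ π_1 for all i ∈ [n], (x^T B)_j ≤ π_2 for all j ∈ [n], and ‖C y − u‖_p ≤ ε/2. Then (x, y) is an ε-Nash equilibrium of the game (A, B). -/
open Finset Matrix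

/-- The `p`-norm of a vector in `ℝ^n`: `(∑ j, |x j| ^ p) ^ (1/p)`. -/
noncomputable def pnorm (p : ℝ) {n : ℕ} (x : Fin n → ℝ) : ℝ :=
  (∑ j, |x j| ^ p) ^ (1 / p)

/-- `(x, y)` is an `ε`-Nash equilibrium of the bimatrix game `(A, B)`. -/
def IsEpsNash {n : ℕ} (A B : Matrix (Fin n) (Fin n) ℝ)
    (x y : Fin n → ℝ) (ε : ℝ) : Prop :=
  (∀ i, A.mulVec y i - ε ≤ x ⬝ᵥ A.mulVec y) ∧
  (∀ j, vecMul x B j - ε ≤ x ⬝ᵥ B.mulVec y)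

/-- **Soundness of the convex program CP(u).** Let `A, B ∈ [−1,1]^{n×n}`,
`C = A + B`, `ε > 0`, `p ≥ 2` and `u ∈ ℝ^n`. If `x, y ∈ Δ^n` and
`π₁, π₂ ∈ [−1,1]` satisfy `xᵀu ≥ π₁ + π₂ − ε/2`, `(Ay)_i ≤ π₁` for all `i`,
`(xᵀB)_j ≤ π₂` for all `j`, and `‖Cy − u‖_p ≤ ε/2`, then `(x, y)` is an
`ε`-Nash equilibrium of `(A, B)`. -/
theorem cp_solution_is_eps_nash (n : ℕ)
    (A B : Matrix (Fin n) (Fin n) ℝ)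
    (hA : ∀ i j, A i j ∈ Set.Icc (-1 : ℝ) 1)
    (hB : ∀ i j, B i j ∈ Set.Icc (-1 : ℝ) 1)
    (ε p : ℝ) (hε : 0 < ε) (hp : 2 ≤ p) (u : Fin n → ℝ)
    (x y : Fin n → ℝ) (π₁ π₂ : ℝ)
    (hx : x ∈ stdSimplex ℝ (Fin n)) (hy : y ∈ stdSimplex ℝ (Fin n))
    (hπ₁ : π₁ ∈ Set.Icc (-1 : ℝ) 1) (hπ₂ : π₂ ∈ Set.Icc (-1 : ℝ) 1)
    (hu : π₁ + π₂ - ε / 2 ≤ x ⬝ᵥ u)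
    (hrow : ∀ i, A.mulVec y i ≤ π₁)
    (hcol : ∀ j, vecMul x B j ≤ π₂)
    (hclose : pnorm p ((A + B).mulVec y - u) ≤ ε / 2) :
    IsEpsNash A B x y ε := by
  have hp0 : 0 < p := by linarith
  have hcoord : ∀ j, |((A + B).mulVec y - u) j| ≤ ε / 2 := by
    intro j
    refine le_trans ?_ hclose
    unfold pnorm
    have h1 : |((A + B).mulVec y - u) j| ^ p ≤ ∑ k, |((A + B).mulVec y - u) k| ^ p :=
      Finset.single_le_sum (f := fun k => |((A + B).mulVec y - u) k| ^ p)
        (fun k _ => Real.rpow_nonneg (abs_nonneg _) p) (Finset.mem_univ j)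
    have h2 := Real.rpow_le_rpow (Real.rpow_nonneg (abs_nonneg _) p) h1
      (by positivity : 0 ≤ 1 / p)
    rwa [← Real.rpow_mul (abs_nonneg _), mul_one_div_cancel hp0.ne', Real.rpow_one] at h2
  have key : ∀ (z v : Fin n → ℝ) (c : ℝ), z ∈ stdSimplex ℝ (Fin n) → (∀ i, v i ≤ c) →
      z ⬝ᵥ v ≤ c := by
    intro z v c hz hv
    calc z ⬝ᵥ v ≤ ∑ i, z i * c :=
          Finset.sum_le_sum fun i _ => mul_le_mul_of_nonneg_left (hv i) (hz.1 i)
      _ = c := by rw [← Finset.sum_mul, hz.2, one_mul]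
  have h1 := key x _ π₁ hx hrow
  have h2 := key y _ π₂ hy hcol
  rw [dotProduct_comm, ← dotProduct_mulVec] at h2
  have h3 := key x (u - (A + B).mulVec y) (ε / 2) hx (fun i => by
    have := (abs_le.mp (hcoord i)).1
    simp only [Pi.sub_apply] at this ⊢
    linarith)
  rw [dotProduct_sub, add_mulVec, dotProduct_add] at h3
  refine ⟨fun i => ?_, fun j => ?_⟩
  · have := hrow i
    linarith
  · have := hcol j
    linarith
end

section
/- Let A, B ∈ [−1,1]^{n×n} be the payoff matrices of a bimatrix game, let C = A + B, let ε > 0, let p ≥ 2 with Hölder conjugate q = p/(p−1), let m ≥ 1, and let u ∈ ℝ^n. Suppose x, y ∈ Δ^n and π_1, π_2 ∈ [−1,1] satisfy: ‖x‖_q ≤ m^{−1/p}, x^T u ≥ π_1 + π_2 − ε/2, (A y)_i ≤ π_1 for all i ∈ [n], (x^T B)_j ≤ π_2 for all j ∈ [n], and ‖C y − u‖_p ≤ (ε · m^{1/p})/2. Then (x, y) is an ε-Nash equilibrium of the game (A, B). -/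
open Finset Matrix

/-- **Soundness of the modified convex program for small-probability games.**
Let `A, B ∈ [−1,1]^{n×n}`, `C = A + B`, `ε > 0`, `p ≥ 2` with Hölder conjugate
`q = p/(p−1)`, `m ≥ 1`, and `u ∈ ℝ^n`. If `x, y ∈ Δ^n` and `π₁, π₂ ∈ [−1,1]`
satisfy `‖x‖_q ≤ m^{−1/p}`, `xᵀu ≥ π₁ + π₂ − ε/2`, `(Ay)_i ≤ π₁` for all `i`,
`(xᵀB)_j ≤ π₂` for all `j`, and `‖Cy − u‖_p ≤ ε m^{1/p} / 2`, then `(x, y)`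
is an `ε`-Nash equilibrium of `(A, B)`. -/
theorem cp_small_prob_solution_is_eps_nash (n : ℕ)
    (A B : Matrix (Fin n) (Fin n) ℝ)
    (hA : ∀ i j, A i j ∈ Set.Icc (-1 : ℝ) 1)
    (hB : ∀ i j, B i j ∈ Set.Icc (-1 : ℝ) 1)
    (ε p q m : ℝ) (hε : 0 < ε) (hp : 2 ≤ p) (hq : q = p / (p - 1))
    (hm : 1 ≤ m) (u : Fin n → ℝ)
    (x y : Fin n → ℝ) (π₁ π₂ : ℝ)
    (hx : x ∈ stdSimplex ℝ (Fin n)) (hy : y ∈ stdSimplex ℝ (Fin n))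
    (hπ₁ : π₁ ∈ Set.Icc (-1 : ℝ) 1) (hπ₂ : π₂ ∈ Set.Icc (-1 : ℝ) 1)
    (hxq : pnorm q x ≤ m ^ (-(1 / p)))
    (hu : π₁ + π₂ - ε / 2 ≤ x ⬝ᵥ u)
    (hrow : ∀ i, A.mulVec y i ≤ π₁)
    (hcol : ∀ j, vecMul x B j ≤ π₂)
    (hclose : pnorm p ((A + B).mulVec y - u) ≤ ε * m ^ (1 / p) / 2) :
    IsEpsNash A B x y ε := by
  have hpq : p.HolderConjugate q := by
    rw [hq]
    exact Real.HolderConjugate.conjExponent (by linarith)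
  have hC : x ⬝ᵥ (A + B).mulVec y = x ⬝ᵥ A.mulVec y + x ⬝ᵥ B.mulVec y := by
    rw [Matrix.add_mulVec, dotProduct_add]
  have hmpos : 0 < m := by linarith
  have hH : x ⬝ᵥ (u - (A + B).mulVec y) ≤ ε / 2 := by
    have h1 := Real.inner_le_Lp_mul_Lq Finset.univ x (u - (A + B).mulVec y) hpq.symm
    have h2 : pnorm p (u - (A + B).mulVec y) = pnorm p ((A + B).mulVec y - u) := by
      unfold pnorm
      congr 1
      refine Finset.sum_congr rfl fun i _ => ?_
      rw [Pi.sub_apply, Pi.sub_apply, abs_sub_comm]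
    have h3 : x ⬝ᵥ (u - (A + B).mulVec y) ≤ pnorm q x * pnorm p ((A + B).mulVec y - u) := by
      rw [← h2]
      exact h1
    have h0 : 0 ≤ pnorm p ((A + B).mulVec y - u) := by
      unfold pnorm
      positivity
    have h4 := mul_le_mul hxq hclose h0 (Real.rpow_nonneg hmpos.le _)
    have h5 : m ^ (-(1 / p)) * (ε * m ^ (1 / p) / 2) = ε / 2 := by
      rw [Real.rpow_neg hmpos.le]
      have := (Real.rpow_pos_of_pos hmpos (1 / p)).ne'
      field_simp
    linarith
  rw [dotProduct_sub, hC] at hH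
  have hAx : x ⬝ᵥ A.mulVec y ≤ π₁ := by
    calc x ⬝ᵥ A.mulVec y ≤ ∑ i, x i * π₁ :=
          Finset.sum_le_sum fun i _ => mul_le_mul_of_nonneg_left (hrow i) (hx.1 i)
      _ = π₁ := by rw [← Finset.sum_mul, hx.2, one_mul]
  have hBx : x ⬝ᵥ B.mulVec y ≤ π₂ := by
    rw [dotProduct_mulVec]
    calc vecMul x B ⬝ᵥ y ≤ ∑ i, π₂ * y i :=
          Finset.sum_le_sum fun i _ => mul_le_mul_of_nonneg_right (hcol i) (hy.1 i)
      _ = π₂ := by rw [← Finset.mul_sum, hy.2, mul_one]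
  refine ⟨fun i => ?_, fun j => ?_⟩
  · have := hrow i
    linarith
  · have := hcol j
    linarith
end

section
/- Let A, B ∈ [−1,1]^{n×n} be the payoff matrices of a bimatrix game, let C = A + B, each of whose columns has at most s nonzero entries, where s ≥ 4, and let p = log₂ s. Then for every y ∈ Δ^n, every ε > 0, and every integer m ≥ 256 · log₂(s) / ε², there exists an m-uniform vector u in the convex hull of the columns C^1, …, C^n of C such that ‖C y − u‖_p ≤ ε/2. -/
open Finset Matrix

open Real in
theorem aux_deriv_mul (p : ℝ) (hp : 2 ≤ p) (x : ℝ) :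
    HasDerivAt (fun x : ℝ => |x| ^ (p - 2) * x) ((p - 1) * |x| ^ (p - 2)) x := by
  by_cases hx : x = 0
  · subst hx
    have hval : (p - 1) * |(0:ℝ)| ^ (p - 2) = |(0:ℝ)| ^ (p - 2) := by
      rcases hp.eq_or_lt with h | h
      · subst h; norm_num
      · rw [abs_zero, Real.zero_rpow (by linarith)]; simp
    rw [hval, hasDerivAt_iff_tendsto_slope]
    have hc : ContinuousAt (fun x : ℝ => |x| ^ (p - 2)) 0 :=
      (continuous_abs.rpow_const (fun x => Or.inr (by linarith))).continuousAt
    refine (hc.tendsto.mono_left nhdsWithin_le_nhds).congr' ?_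
    filter_upwards [self_mem_nhdsWithin] with y hy
    have hy' : y ≠ 0 := hy
    simp [slope_def_field, hy']
  · have h1 := ((hasDerivAt_abs hx).rpow_const (p := p - 2)
      (Or.inl (abs_ne_zero.mpr hx))).mul (hasDerivAt_id x)
    refine HasDerivAt.congr_deriv h1 ?_
    have h2 : |x| ^ (p - 2) = |x| ^ (p - 2 - 1) * |x| := by
      rw [Real.rpow_sub_one (abs_ne_zero.mpr hx)]
      field_simp
    have h3 : (SignType.sign x : ℝ) * x = |x| := by
      simp
    simp only [id]
    rw [h2]
    linear_combination (p - 2) * |x| ^ (p - 2 - 1) * h3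

theorem aux_taylor (N N1 N2 : ℝ → ℝ) (K : ℝ) (h1 : ∀ t, HasDerivAt N (N1 t) t)
    (h2 : ∀ t, HasDerivAt N1 (N2 t) t) (hK : ∀ t, N2 t ≤ 2 * K) :
    N 1 ≤ N 0 + N1 0 + K := by
  have d1 : ∀ t, HasDerivAt (fun t => N1 t - (2 * K) * t) (N2 t - 2 * K) t := fun t => by
    exact ((h2 t).sub ((hasDerivAt_id t).const_mul (2 * K))).congr_deriv (by simp)
  have a1 : Antitone (fun t => N1 t - (2 * K) * t) :=
    antitone_of_hasDerivAt_nonpos d1 (fun t => by simpa using hK t)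
  have d2 : ∀ t, HasDerivAt (fun t => N t - N1 0 * t - K * t ^ 2)
      (N1 t - N1 0 - K * (2 * t)) t := fun t => by
    exact (((h1 t).sub ((hasDerivAt_id t).const_mul (N1 0))).sub
      ((hasDerivAt_pow 2 t).const_mul K)).congr_deriv (by simp)
  have a2 : AntitoneOn (fun t => N t - N1 0 * t - K * t ^ 2) (Set.Ici 0) := by
    apply antitoneOn_of_hasDerivWithinAt_nonpos (convex_Ici 0)
      (fun t _ => (d2 t).continuousAt.continuousWithinAt) (fun t _ => (d2 t).hasDerivWithinAt)
    intro t ht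
    have ht' : 0 ≤ t := interior_subset ht
    have := a1 ht'
    simp only at this
    linarith
  have := a2 (Set.mem_Ici.mpr le_rfl) (Set.mem_Ici.mpr zero_le_one) zero_le_one
  simp only at this
  linarith

theorem aux_holder {n : ℕ} (p : ℝ) (hp : 2 ≤ p) (z h : Fin n → ℝ) (H : ℝ) (hH : 0 < H)
    (hh : ∑ i, |h i| ^ p ≤ H ^ p) :
    (1 + ∑ i, |z i| ^ p) ^ (2 / p - 1) * ∑ i, |z i| ^ (p - 2) * h i ^ 2 ≤ H ^ 2 := by
  have hp0 : 0 < p := by linarith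
  set F := 1 + ∑ i, |z i| ^ p with hF
  have hS : 0 ≤ ∑ i, |z i| ^ p := Finset.sum_nonneg (fun i _ => by positivity)
  have hF0 : 0 < F := by linarith
  have hHp : 0 < H ^ p := by positivity
  have key : ∀ i, F ^ (2 / p - 1) * (|z i| ^ (p - 2) * h i ^ 2) / H ^ 2 ≤
      (1 - 2 / p) * (|z i| ^ p / F) + (2 / p) * (|h i| ^ p / H ^ p) := by
    intro i
    have h2p : 2 / p ≤ 1 := by rw [div_le_one hp0]; exact hp
    have := Real.geom_mean_le_arith_mean2_weighted (w₁ := 1 - 2 / p) (w₂ := 2 / p)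
      (p₁ := |z i| ^ p / F) (p₂ := |h i| ^ p / H ^ p) (by linarith) (by positivity)
      (by positivity) (by positivity) (by ring)
    refine le_trans (le_of_eq ?_) this
    rw [Real.div_rpow (by positivity) hF0.le, Real.div_rpow (by positivity) hHp.le,
      ← Real.rpow_mul (abs_nonneg _), ← Real.rpow_mul (abs_nonneg _), ← Real.rpow_mul hH.le]
    have e1 : p * (1 - 2 / p) = p - 2 := by field_simp
    have e2 : p * (2 / p) = 2 := by field_simp
    rw [e1, e2, show 2 / p - 1 = -(1 - 2 / p) by ring, Real.rpow_neg hF0.le,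
      Real.rpow_two, Real.rpow_two, sq_abs]
    field_simp
  have hsum := Finset.sum_le_sum (fun i (_ : i ∈ Finset.univ) => key i)
  rw [← Finset.sum_div, ← Finset.mul_sum, Finset.sum_add_distrib, ← Finset.mul_sum,
    ← Finset.mul_sum, ← Finset.sum_div, ← Finset.sum_div] at hsum
  have b1 : (∑ i, |z i| ^ p) / F ≤ 1 := by rw [div_le_one hF0]; linarith
  have b2 : (∑ i, |h i| ^ p) / H ^ p ≤ 1 := by rwa [div_le_one hHp]
  have h2p : 2 / p ≤ 1 := by rw [div_le_one hp0]; exact hp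
  have h2p0 : 0 ≤ 2 / p := by positivity
  have : F ^ (2 / p - 1) * (∑ i, |z i| ^ (p - 2) * h i ^ 2) / H ^ 2 ≤ 1 := by
    refine hsum.trans ?_
    nlinarith [mul_le_mul_of_nonneg_left b1 (sub_nonneg.mpr h2p),
      mul_le_mul_of_nonneg_left b2 h2p0]
  rwa [div_le_one (by positivity)] at this

theorem aux_smooth {n : ℕ} (p : ℝ) (hp : 2 ≤ p) (x : Fin n → ℝ) :
    ∃ w : Fin n → ℝ, ∀ (h : Fin n → ℝ) (H : ℝ), 0 < H → ∑ i, |h i| ^ p ≤ H ^ p →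
      (1 + ∑ i, |x i + h i| ^ p) ^ (2 / p) ≤
        (1 + ∑ i, |x i| ^ p) ^ (2 / p) + ∑ i, w i * h i + (p - 1) * H ^ 2 := by
  have hp0 : 0 < p := by linarith
  refine ⟨fun i => p * (|x i| ^ (p - 2) * x i) * (2 / p) *
    (1 + ∑ i, |x i| ^ p) ^ (2 / p - 1), ?_⟩
  intro h H hH hh
  let z : ℝ → Fin n → ℝ := fun t i => x i + t * h i
  let F : ℝ → ℝ := fun t => 1 + ∑ i, |z t i| ^ p
  let F1 : ℝ → ℝ := fun t => ∑ i, p * (|z t i| ^ (p - 2) * z t i) * h i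
  let F2 : ℝ → ℝ := fun t => ∑ i, p * (((p - 1) * |z t i| ^ (p - 2)) * h i) * h i
  have hF0 : ∀ t, 0 < F t := fun t => by
    have : 0 ≤ ∑ i, |z t i| ^ p := Finset.sum_nonneg (fun i _ => by positivity)
    simp only [F]; linarith
  have dz : ∀ t i, HasDerivAt (fun t => z t i) (h i) t := fun t i => by
    exact (((hasDerivAt_id t).mul_const (h i)).const_add (x i)).congr_deriv (by simp)
  have dF : ∀ t, HasDerivAt F (F1 t) t := fun t => by
    refine HasDerivAt.const_add 1 (HasDerivAt.fun_sum (fun i _ => ?_))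
    refine ((hasDerivAt_abs_rpow (z t i) (by linarith : 1 < p)).comp t (dz t i)).congr_deriv ?_
    ring
  have dF1 : ∀ t, HasDerivAt F1 (F2 t) t := fun t => by
    refine HasDerivAt.fun_sum (fun i _ => ?_)
    exact ((((aux_deriv_mul p hp (z t i)).comp t (dz t i)).const_mul p).mul_const (h i))
  have T := aux_taylor (fun t => F t ^ (2 / p)) (fun t => F1 t * (2 / p) * F t ^ (2 / p - 1))
    (fun t => F2 t * (2 / p) * F t ^ (2 / p - 1) +
      F1 t * (2 / p) * (F1 t * (2 / p - 1) * F t ^ (2 / p - 1 - 1))) ((p - 1) * H ^ 2)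
    (fun t => (dF t).rpow_const (Or.inl (hF0 t).ne'))
    (fun t => ((dF1 t).mul_const (2 / p)).mul ((dF t).rpow_const (Or.inl (hF0 t).ne'))) ?_
  · have e1 : F 1 = 1 + ∑ i, |x i + h i| ^ p := by simp [F, z]
    have e0 : F 0 = 1 + ∑ i, |x i| ^ p := by simp [F, z]
    have e2 : F1 0 * (2 / p) * F 0 ^ (2 / p - 1) = ∑ i, p * (|x i| ^ (p - 2) * x i) * (2 / p) *
        (1 + ∑ i, |x i| ^ p) ^ (2 / p - 1) * h i := by
      rw [e0]
      simp only [F1, z, zero_mul, add_zero, Finset.sum_mul]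
      exact Finset.sum_congr rfl (fun i _ => by ring)
    rw [e2, e1, e0] at T
    exact T
  · intro t
    have hol := aux_holder p hp (z t) h H hH hh
    have n1 : F1 t * (2 / p) * (F1 t * (2 / p - 1) * F t ^ (2 / p - 1 - 1)) ≤ 0 := by
      have h2p : 2 / p - 1 ≤ 0 := by
        have : 2 / p ≤ 1 := by rw [div_le_one hp0]; exact hp
        linarith
      have : 0 ≤ F1 t ^ 2 * (2 / p) * F t ^ (2 / p - 1 - 1) := by
        have := hF0 t
        positivity
      nlinarith
    have n2 : F2 t * (2 / p) * F t ^ (2 / p - 1) = 2 * (p - 1) *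
        (F t ^ (2 / p - 1) * ∑ i, |z t i| ^ (p - 2) * h i ^ 2) := by
      have : F2 t = p * (p - 1) * ∑ i, |z t i| ^ (p - 2) * h i ^ 2 := by
        simp only [F2, Finset.mul_sum]
        exact Finset.sum_congr rfl (fun i _ => by ring)
      rw [this]
      field_simp
    have n3 := mul_le_mul_of_nonneg_left hol (by linarith : (0:ℝ) ≤ 2 * (p - 1))
    rw [n2]
    simp only [F] at n1 ⊢
    linarith

theorem aux_sub_rpow (p : ℝ) (hp : 1 ≤ p) (a b : ℝ) :
    |a - b| ^ p ≤ 2 ^ (p - 1) * (|a| ^ p + |b| ^ p) := by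
  have h1 : |a - b| ^ p ≤ (|a| + |b|) ^ p :=
    Real.rpow_le_rpow (abs_nonneg _) (abs_sub a b) (by linarith)
  refine h1.trans ?_
  have := (convexOn_rpow hp).2 (Set.mem_Ici.mpr (abs_nonneg a)) (Set.mem_Ici.mpr (abs_nonneg b))
    (by norm_num : (0:ℝ) ≤ 1/2) (by norm_num : (0:ℝ) ≤ 1/2) (by norm_num)
  simp only [smul_eq_mul] at this
  rw [← mul_add, ← mul_add, Real.mul_rpow (by norm_num) (by positivity),
    one_div, Real.inv_rpow (by norm_num)] at this
  have h2 : (0:ℝ) < 2 ^ p := by positivity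
  rw [Real.rpow_sub_one (by norm_num)]
  rw [inv_mul_le_iff₀ h2] at this
  linarith

theorem aux_greedy {n : ℕ} (p : ℝ) (hp : 2 ≤ p) (h : Fin n → Fin n → ℝ)
    (y : Fin n → ℝ) (hy : y ∈ stdSimplex ℝ (Fin n)) (h0 : ∀ i, ∑ j, y j * h j i = 0)
    (H : ℝ) (hH : 0 < H) (hh : ∀ j, ∑ i, |h j i| ^ p ≤ H ^ p) (m : ℕ) :
    ∃ f : Fin m → Fin n,
      (1 + ∑ i, |∑ k, h (f k) i| ^ p) ^ (2 / p) ≤ 1 + (p - 1) * H ^ 2 * m := by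
  induction m with
  | zero =>
    refine ⟨Fin.elim0, ?_⟩
    simp [Real.zero_rpow (by linarith : p ≠ 0)]
  | succ m ih =>
    obtain ⟨f, hf⟩ := ih
    obtain ⟨w, hw⟩ := aux_smooth p hp (fun i => ∑ k, h (f k) i)
    have : ∃ j, ∑ i, w i * h j i ≤ 0 := by
      by_contra! hc
      have hz : ∑ j, y j * ∑ i, w i * h j i = 0 := by
        simp only [Finset.mul_sum]
        rw [Finset.sum_comm]
        refine Finset.sum_eq_zero (fun i _ => ?_)
        rw [show ∑ j, y j * (w i * h j i) = w i * ∑ j, y j * h j i by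
          rw [Finset.mul_sum]; exact Finset.sum_congr rfl (fun j _ => by ring), h0, mul_zero]
      have hz' := (Finset.sum_eq_zero_iff_of_nonneg
        (fun j _ => mul_nonneg (hy.1 j) (hc j).le)).mp hz
      have : ∑ j, y j = 0 := Finset.sum_eq_zero (fun j hj =>
        (mul_eq_zero.mp (hz' j hj)).resolve_right (hc j).ne')
      rw [hy.2] at this
      exact one_ne_zero this
    obtain ⟨j, hj⟩ := this
    refine ⟨Fin.snoc f j, ?_⟩
    have := hw (h j) H hH (hh j)
    simp only [Fin.sum_univ_castSucc, Fin.snoc_castSucc, Fin.snoc_last]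
    push_cast
    linarith

theorem aux_bound {n : ℕ} (p : ℝ) (hp : 2 ≤ p) (C : Matrix (Fin n) (Fin n) ℝ) (D : ℝ)
    (hD : ∀ j, ∑ i, |C i j| ^ p ≤ D) (y : Fin n → ℝ) (hy : y ∈ stdSimplex ℝ (Fin n))
    (j : Fin n) : ∑ i, |C i j - C.mulVec y i| ^ p ≤ 2 ^ p * D := by
  have hJ : ∀ i, |C.mulVec y i| ^ p ≤ ∑ k, y k * |C i k| ^ p := by
    intro i
    have h1 : |C.mulVec y i| ≤ ∑ k, y k * |C i k| := by
      simp only [Matrix.mulVec, dotProduct]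
      refine (Finset.abs_sum_le_sum_abs _ _).trans (le_of_eq ?_)
      exact Finset.sum_congr rfl (fun k _ => by rw [abs_mul, abs_of_nonneg (hy.1 k), mul_comm])
    refine (Real.rpow_le_rpow (abs_nonneg _) h1 (by linarith)).trans ?_
    exact Real.rpow_arith_mean_le_arith_mean_rpow _ _ _ (fun k _ => hy.1 k) hy.2
      (fun k _ => abs_nonneg _) (by linarith)
  have hs : ∑ i, |C.mulVec y i| ^ p ≤ D := by
    refine (Finset.sum_le_sum (fun i _ => hJ i)).trans ?_
    rw [Finset.sum_comm]
    calc ∑ k, ∑ i, y k * |C i k| ^ p ≤ ∑ k, y k * D := by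
          refine Finset.sum_le_sum (fun k _ => ?_)
          rw [← Finset.mul_sum]
          exact mul_le_mul_of_nonneg_left (hD k) (hy.1 k)
      _ = D := by rw [← Finset.sum_mul, hy.2, one_mul]
  calc ∑ i, |C i j - C.mulVec y i| ^ p
      ≤ ∑ i, 2 ^ (p - 1) * (|C i j| ^ p + |C.mulVec y i| ^ p) :=
        Finset.sum_le_sum (fun i _ => aux_sub_rpow p (by linarith) _ _)
    _ = 2 ^ (p - 1) * (∑ i, |C i j| ^ p + ∑ i, |C.mulVec y i| ^ p) := by
        rw [← Finset.mul_sum, Finset.sum_add_distrib]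
    _ ≤ 2 ^ (p - 1) * (D + D) :=
        mul_le_mul_of_nonneg_left (add_le_add (hD j) hs) (by positivity)
    _ = 2 ^ p * D := by rw [Real.rpow_sub_one (by norm_num)]; ring

/-- **Completeness of the equilibrium algorithm for sparse games.** Let
`A, B ∈ [−1,1]^{n×n}`, let `C = A + B` have at most `s` nonzero entries in
every column, with `s ≥ 4`, and let `p = log₂ s`. Then for every `y ∈ Δ^n`,
every `ε > 0` and every integer `m ≥ 256 log₂(s)/ε²`, there is an `m`-uniform
vector `u = (1/m) ∑_{k=1}^m C^{f k}` in the convex hull of the columns of `C`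
with `‖Cy − u‖_p ≤ ε/2`. -/
theorem exists_uniform_column_combination_close (n s : ℕ) (hs : 4 ≤ s)
    (A B : Matrix (Fin n) (Fin n) ℝ)
    (hA : ∀ i j, A i j ∈ Set.Icc (-1 : ℝ) 1)
    (hB : ∀ i j, B i j ∈ Set.Icc (-1 : ℝ) 1)
    (hsparse : ∀ j, (Finset.univ.filter fun i => (A + B) i j ≠ 0).card ≤ s)
    (y : Fin n → ℝ) (hy : y ∈ stdSimplex ℝ (Fin n))
    (ε : ℝ) (hε : 0 < ε)
    (m : ℕ) (hm : 256 * Real.logb 2 s / ε ^ 2 ≤ (m : ℝ)) :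
    ∃ f : Fin m → Fin n,
      pnorm (Real.logb 2 s)
          ((A + B).mulVec y - (m : ℝ)⁻¹ • ∑ k, (fun i => (A + B) i (f k)))
        ≤ ε / 2 := by
  set C := A + B with hC
  set p := Real.logb 2 s with hpdef
  have hs0 : (0:ℝ) < s := by
    have : 0 < s := by omega
    exact_mod_cast this
  have hsp : (2:ℝ) ^ p = s := Real.rpow_logb (by norm_num) (by norm_num) hs0
  have hp : 2 ≤ p := by
    rw [hpdef, Real.le_logb_iff_rpow_le (by norm_num) hs0]
    have : (4:ℝ) ≤ s := by exact_mod_cast hs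
    norm_num
    exact hs
  have hp0 : 0 < p := by linarith
  have hm0 : (0:ℝ) < m := lt_of_lt_of_le (by positivity) hm
  have hm1 : (1:ℝ) ≤ m := by
    have : 0 < m := by exact_mod_cast hm0
    exact_mod_cast this
  have hent : ∀ i j, |C i j| ≤ 2 := by
    intro i j
    have h1 := hA i j
    have h2 := hB i j
    rw [hC, Matrix.add_apply, abs_le]
    constructor <;> linarith [h1.1, h1.2, h2.1, h2.2]
  have hD : ∀ j, ∑ i, |C i j| ^ p ≤ 4 ^ p := by
    intro j
    have e : ∑ i, |C i j| ^ p = ∑ i ∈ Finset.univ.filter (fun i => C i j ≠ 0), |C i j| ^ p := by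
      symm
      apply Finset.sum_subset (Finset.subset_univ _)
      intro i _ hi
      have : C i j = 0 := by simpa using hi
      rw [this, abs_zero, Real.zero_rpow hp0.ne']
    rw [e]
    calc _ ≤ ∑ i ∈ Finset.univ.filter (fun i => C i j ≠ 0), (2:ℝ) ^ p :=
          Finset.sum_le_sum (fun i _ => Real.rpow_le_rpow (abs_nonneg _) (hent i j) hp0.le)
      _ = ((Finset.univ.filter (fun i => C i j ≠ 0)).card : ℝ) * 2 ^ p := by
          rw [Finset.sum_const, nsmul_eq_mul]
      _ ≤ (s : ℝ) * 2 ^ p := by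
          apply mul_le_mul_of_nonneg_right _ (by positivity)
          exact_mod_cast hsparse j
      _ = 4 ^ p := by
          rw [← hsp, ← Real.mul_rpow (by norm_num) (by norm_num)]; norm_num
  have hh : ∀ j, ∑ i, |C i j - C.mulVec y i| ^ p ≤ (8:ℝ) ^ p := by
    intro j
    refine (aux_bound p hp C _ hD y hy j).trans (le_of_eq ?_)
    rw [← Real.mul_rpow (by norm_num) (by norm_num)]; norm_num
  have h0 : ∀ i, ∑ j, y j * (C i j - C.mulVec y i) = 0 := by
    intro i
    simp only [mul_sub, Finset.sum_sub_distrib, ← Finset.sum_mul, hy.2, one_mul]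
    simp only [Matrix.mulVec, dotProduct]
    rw [sub_eq_zero]
    exact Finset.sum_congr rfl (fun j _ => mul_comm _ _)
  obtain ⟨f, hf⟩ := aux_greedy p hp (fun j i => C i j - C.mulVec y i) y hy h0 8 (by norm_num) hh m
  refine ⟨f, ?_⟩
  set S : Fin n → ℝ := fun i => ∑ k, (C i (f k) - C.mulVec y i) with hS
  have hvec : ∀ i, |(C.mulVec y - (m : ℝ)⁻¹ • ∑ k, (fun i => C i (f k))) i| ^ p
      = ((m:ℝ)⁻¹) ^ p * |S i| ^ p := by
    intro i
    rw [← Real.mul_rpow (by positivity) (abs_nonneg _)]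
    congr 1
    rw [← abs_of_pos (inv_pos.mpr hm0), ← abs_mul, ← abs_neg, abs_of_pos (inv_pos.mpr hm0)]
    congr 1
    simp only [hS, Pi.sub_apply, Pi.smul_apply, Finset.sum_apply, smul_eq_mul,
      Finset.sum_sub_distrib, Finset.sum_const, Finset.card_univ, Fintype.card_fin, nsmul_eq_mul]
    field_simp
    ring
  have hG0 : 0 ≤ ∑ i, |S i| ^ p := Finset.sum_nonneg (fun i _ => by positivity)
  have hpn : pnorm p (C.mulVec y - (m : ℝ)⁻¹ • ∑ k, (fun i => C i (f k)))
      = (m:ℝ)⁻¹ * (∑ i, |S i| ^ p) ^ (1 / p) := by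
    unfold pnorm
    rw [Finset.sum_congr rfl (fun i _ => hvec i), ← Finset.mul_sum,
      Real.mul_rpow (by positivity) hG0, ← Real.rpow_mul (by positivity),
      mul_one_div_cancel hp0.ne', Real.rpow_one]
  rw [hpn]
  set R := (∑ i, |S i| ^ p) ^ (1 / p) with hR
  have hR2 : R ^ 2 ≤ 64 * p * m := by
    have e : R ^ 2 = (∑ i, |S i| ^ p) ^ (2 / p) := by
      rw [hR, ← Real.rpow_natCast, ← Real.rpow_mul hG0]
      congr 1
      push_cast
      ring
    have le : (∑ i, |S i| ^ p) ^ (2 / p) ≤ (1 + ∑ i, |S i| ^ p) ^ (2 / p) :=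
      Real.rpow_le_rpow hG0 (by linarith) (by positivity)
    have hf' : (1 + ∑ i, |S i| ^ p) ^ (2 / p) ≤ 1 + (p - 1) * 8 ^ 2 * m := hf
    rw [e]
    nlinarith
  have hm' : 256 * p ≤ m * ε ^ 2 := by
    rwa [div_le_iff₀ (by positivity)] at hm
  rw [inv_mul_le_iff₀ hm0]
  apply le_of_sq_le_sq _ (by positivity)
  nlinarith
end
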